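/- arXiv:2506.04802 — 9 statements merged into one kernel-verified Lean document; each statement's English description precedes it below -/
import Mathlib

section
/- Fix x ∈ ℝ^n, λ ∈ ℝ^m, μ > 0, ρ > 0 and let s⋆ := s(x,λ;μ,ρ) be given by the componentwise closed-form formula. Then s⋆ ∈ (0,∞)^n, s⋆ satisfies the stationarity equation −ρμ/s⋆_i + ρx_i + (Aᵀλ)_i + s⋆_i − c_i = 0 for every i = 1,…,n, and s⋆ is the unique global minimizer of s ↦ L(x,λ,s;μ,ρ) over (0,∞)^n: for every s ∈ (0,∞)^n with s ≠ s⋆ one has L(x,λ,s;μ,ρ) > L(x,λ,s⋆;μ,ρ). -/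
open scoped BigOperators

noncomputable def svec {m n : ℕ} (A : Matrix (Fin m) (Fin n) ℝ) (c x : Fin n → ℝ)
    (lam : Fin m → ℝ) (μ ρ : ℝ) : Fin n → ℝ := fun i =>
  (Real.sqrt ((ρ * x i - c i + A.transpose.mulVec lam i) ^ 2 + 4 * ρ * μ)
    - (ρ * x i - c i + A.transpose.mulVec lam i)) / 2

noncomputable def zvec {m n : ℕ} (A : Matrix (Fin m) (Fin n) ℝ) (c x : Fin n → ℝ)
    (lam : Fin m → ℝ) (μ ρ : ℝ) : Fin n → ℝ := fun i =>
  (Real.sqrt ((ρ * x i - c i + A.transpose.mulVec lam i) ^ 2 + 4 * ρ * μ)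
    + (ρ * x i - c i + A.transpose.mulVec lam i)) / 2

noncomputable def phi {n : ℕ} (y : Fin n → ℝ) : ℝ := -∑ i, Real.log (y i)

noncomputable def Lag {m n : ℕ} (A : Matrix (Fin m) (Fin n) ℝ) (b : Fin m → ℝ)
    (c x : Fin n → ℝ) (lam : Fin m → ℝ) (s : Fin n → ℝ) (μ ρ : ℝ) : ℝ :=
  -(ρ * ∑ j, b j * lam j) + ρ * μ * phi s
    + ρ * ∑ i, x i * (A.transpose.mulVec lam i + s i - c i)
    + (1 / 2) * ∑ i, (A.transpose.mulVec lam i + s i - c i) ^ 2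

noncomputable def eta {m n : ℕ} (A : Matrix (Fin m) (Fin n) ℝ) (b : Fin m → ℝ)
    (c x : Fin n → ℝ) (lam : Fin m → ℝ) (μ ρ : ℝ) : ℝ :=
  Lag A b c x lam (svec A c x lam μ ρ) μ ρ

theorem half_sqrt_sub_pos (u : ℝ) {k : ℝ} (hk : 0 < k) :
    0 < (Real.sqrt (u ^ 2 + 4 * k) - u) / 2 := by
  have h : u < Real.sqrt (u ^ 2 + 4 * k) := Real.lt_sqrt_of_sq_lt (by linarith)
  linarith

theorem half_sqrt_sub_mul_self_add (u : ℝ) {k : ℝ} (hk : 0 < k) :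
    (Real.sqrt (u ^ 2 + 4 * k) - u) / 2 * ((Real.sqrt (u ^ 2 + 4 * k) - u) / 2 + u) = k := by
  have h : Real.sqrt (u ^ 2 + 4 * k) ^ 2 = u ^ 2 + 4 * k := Real.sq_sqrt (by positivity)
  linear_combination h / 4

/-- A positive stationary point `t` of `s ↦ -k log s + p (a + s) + (a + s)² / 2` is its strict
global minimizer on the positive half-line; stationarity is `t (t + p + a) = k`. -/
theorem log_barrier_quadratic_lt {k p a t s : ℝ} (hk : 0 < k) (ht : 0 < t) (hs : 0 < s)
    (hst : s ≠ t) (hstat : t * (t + (p + a)) = k) :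
    -(k * Real.log t) + p * (a + t) + 1 / 2 * (a + t) ^ 2 <
      -(k * Real.log s) + p * (a + s) + 1 / 2 * (a + s) ^ 2 := by
  have hlog : Real.log s - Real.log t ≤ s / t - 1 := by
    rw [← Real.log_div hs.ne' ht.ne']
    exact Real.log_le_sub_one_of_pos (div_pos hs ht)
  have hmul := mul_le_mul_of_nonneg_left hlog hk.le
  have hlin : k * (s / t - 1) = (t + (p + a)) * (s - t) := by
    rw [← hstat]
    field_simp
  have hsq : 0 < (s - t) ^ 2 := by
    have := sub_ne_zero.mpr hst
    positivity
  nlinarith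

theorem Lag_eq_sum {m n : ℕ} (A : Matrix (Fin m) (Fin n) ℝ) (b : Fin m → ℝ)
    (c x : Fin n → ℝ) (lam : Fin m → ℝ) (s : Fin n → ℝ) (μ ρ : ℝ) :
    Lag A b c x lam s μ ρ = -(ρ * ∑ j, b j * lam j) +
      ∑ i, (-(ρ * μ * Real.log (s i)) + ρ * x i * (A.transpose.mulVec lam i - c i + s i) +
        1 / 2 * (A.transpose.mulVec lam i - c i + s i) ^ 2) := by
  simp only [Lag, phi, Finset.sum_add_distrib, Finset.sum_neg_distrib, mul_neg, Finset.mul_sum,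
    mul_assoc, add_sub_right_comm, add_assoc]

/-- `svec` is positive, satisfies the stationarity equation, and is the
unique global minimizer of the augmented Lagrangian over the positive orthant. -/
theorem stmt0 {m n : ℕ} (A : Matrix (Fin m) (Fin n) ℝ) (b : Fin m → ℝ) (c : Fin n → ℝ)
    (x : Fin n → ℝ) (lam : Fin m → ℝ) (μ ρ : ℝ) (hμ : 0 < μ) (hρ : 0 < ρ) :
    (∀ i, 0 < svec A c x lam μ ρ i) ∧
    (∀ i, -(ρ * μ) / svec A c x lam μ ρ i + ρ * x i + A.transpose.mulVec lam i
        + svec A c x lam μ ρ i - c i = 0) ∧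
    (∀ s : Fin n → ℝ, (∀ i, 0 < s i) → s ≠ svec A c x lam μ ρ →
      Lag A b c x lam (svec A c x lam μ ρ) μ ρ < Lag A b c x lam s μ ρ) := by
  have hk : 0 < ρ * μ := mul_pos hρ hμ
  have hpos : ∀ i, 0 < svec A c x lam μ ρ i := fun i => by
    simpa only [svec, mul_assoc] using half_sqrt_sub_pos _ hk
  have hstat : ∀ i, svec A c x lam μ ρ i *
      (svec A c x lam μ ρ i + (ρ * x i + (A.transpose.mulVec lam i - c i))) = ρ * μ := fun i => by
    have h := half_sqrt_sub_mul_self_add (ρ * x i - c i + A.transpose.mulVec lam i) hk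
    rw [← mul_assoc] at h
    change svec A c x lam μ ρ i * (svec A c x lam μ ρ i + _) = _ at h
    linear_combination h
  refine ⟨hpos, fun i => ?_, fun s hs hne => ?_⟩
  · have hi := (hpos i).ne'
    field_simp
    linear_combination hstat i
  · obtain ⟨j, hj⟩ := Function.ne_iff.mp hne
    rw [Lag_eq_sum, Lag_eq_sum]
    gcongr ?_ + ?_
    refine Finset.sum_lt_sum (fun i _ => ?_) ⟨j, Finset.mem_univ j,
      log_barrier_quadratic_lt hk (hpos j) (hs j) hj (hstat j)⟩
    by_cases hi : s i = svec A c x lam μ ρ i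
    · rw [hi]
    · exact (log_barrier_quadratic_lt hk (hpos i) (hs i) hi (hstat i)).le
end

section
/- Fix x ∈ ℝ^n, μ > 0, ρ > 0. The function λ ↦ η(x,λ;μ,ρ) is differentiable on ℝ^m, and its gradient at every λ equals A·z(x,λ;μ,ρ) − ρb. -/
open scoped BigOperators

/-- The scalar barrier term, up to a constant, is a primitive of the positive root `z`. -/
lemma hasDerivAt_barrier_potential {μ ρ : ℝ} (hμ : 0 < μ) (hρ : 0 < ρ) (u : ℝ) :
    HasDerivAt (fun v : ℝ => -(ρ * μ * Real.log ((√(v ^ 2 + 4 * ρ * μ) - v) / 2))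
        + ((√(v ^ 2 + 4 * ρ * μ) + v) / 2) ^ 2 / 2)
      ((√(u ^ 2 + 4 * ρ * μ) + u) / 2) u := by
  have hk : 0 < ρ * μ := mul_pos hρ hμ
  have hpos : 0 < u ^ 2 + 4 * ρ * μ := by nlinarith [sq_nonneg u]
  have hsq : √(u ^ 2 + 4 * ρ * μ) ^ 2 = u ^ 2 + 4 * ρ * μ := Real.sq_sqrt hpos.le
  have hr : HasDerivAt (fun v : ℝ => √(v ^ 2 + 4 * ρ * μ)) (u / √(u ^ 2 + 4 * ρ * μ)) u := by
    have h := (((hasDerivAt_id' u).pow 2).add_const (4 * ρ * μ)).sqrt hpos.ne'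
    refine h.congr_deriv ?_
    simp only [Pi.pow_apply]
    field_simp
    norm_num
  have hr0 : 0 < √(u ^ 2 + 4 * ρ * μ) := Real.sqrt_pos.2 hpos
  have hs : 0 < √(u ^ 2 + 4 * ρ * μ) - u :=
    sub_pos.2 (Real.lt_sqrt_of_sq_lt (by nlinarith))
  have hlog := (((hr.sub (hasDerivAt_id' u)).div_const 2).log (by
    simpa using hs.ne')).const_mul (ρ * μ)
  have hz := (((hr.add (hasDerivAt_id' u)).div_const 2).pow 2).div_const 2
  refine (hlog.neg.add hz).congr_deriv ?_
  simp only [Pi.sub_apply, Pi.add_apply]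
  generalize √(u ^ 2 + 4 * ρ * μ) = r at *
  have hk4 : ρ * μ = (r - u) * (r + u) / 4 := by linarith
  rw [hk4]
  have hs' := hs.ne'
  field_simp
  ring

lemma eta_eq_sum_barrier_potential {m n : ℕ} (A : Matrix (Fin m) (Fin n) ℝ) (b : Fin m → ℝ)
    (c x : Fin n → ℝ) (l : Fin m → ℝ) (μ ρ : ℝ) :
    eta A b c x l μ ρ = -(ρ * ∑ j, b j * l j)
      + ∑ i, (-(ρ * μ * Real.log (svec A c x l μ ρ i)) + zvec A c x l μ ρ i ^ 2 / 2
        - (ρ * x i) ^ 2 / 2) := by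
  have hz : ∀ i, A.transpose.mulVec l i + svec A c x l μ ρ i - c i
      = zvec A c x l μ ρ i - ρ * x i := fun i => by
    simp only [svec, zvec]
    ring
  simp only [eta, Lag, phi, hz]
  rw [mul_neg, Finset.mul_sum (a := ρ * μ),
    Finset.mul_sum (a := ρ) (f := fun i => x i * (zvec A c x l μ ρ i - ρ * x i)),
    Finset.mul_sum (a := (1 / 2 : ℝ)), ← Finset.sum_neg_distrib, add_assoc, add_assoc,
    ← Finset.sum_add_distrib, ← Finset.sum_add_distrib]
  congr 1
  refine Finset.sum_congr rfl fun i _ => ?_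
  ring

/-- `λ ↦ η(x,λ;μ,ρ)` is differentiable with gradient `A z(x,λ;μ,ρ) - ρ b`. -/
theorem stmt4 {m n : ℕ} (A : Matrix (Fin m) (Fin n) ℝ) (b : Fin m → ℝ) (c : Fin n → ℝ)
    (x : Fin n → ℝ) (μ ρ : ℝ) (hμ : 0 < μ) (hρ : 0 < ρ) :
    ∀ lam : Fin m → ℝ,
      HasFDerivAt (fun l : Fin m → ℝ => eta A b c x l μ ρ)
        (∑ j, (A.mulVec (zvec A c x lam μ ρ) j - ρ * b j) •
          (ContinuousLinearMap.proj j : (Fin m → ℝ) →L[ℝ] ℝ)) lam := by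
  intro lam
  have hu : ∀ i, HasFDerivAt (fun l : Fin m → ℝ => ρ * x i - c i + A.transpose.mulVec l i)
      (∑ j, A j i • (ContinuousLinearMap.proj j : (Fin m → ℝ) →L[ℝ] ℝ)) lam := fun i => by
    simp only [Matrix.mulVec, dotProduct, Matrix.transpose_apply]
    exact (HasFDerivAt.fun_sum fun j _ =>
      (hasFDerivAt_apply (𝕜 := ℝ) j lam).const_mul (A j i)).const_add _
  have hlin : HasFDerivAt (fun l : Fin m → ℝ => -(ρ * ∑ j, b j * l j))
      (-(ρ • ∑ j, b j • (ContinuousLinearMap.proj j : (Fin m → ℝ) →L[ℝ] ℝ))) lam :=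
    ((HasFDerivAt.fun_sum fun j _ =>
      (hasFDerivAt_apply (𝕜 := ℝ) j lam).const_mul (b j)).const_mul ρ).neg
  have hsum := HasFDerivAt.fun_sum (u := Finset.univ) fun i _ =>
    ((hasDerivAt_barrier_potential hμ hρ _).comp_hasFDerivAt lam (hu i)).sub_const
      ((ρ * x i) ^ 2 / 2)
  simp only [eta_eq_sum_barrier_potential]
  refine (hlin.add hsum).congr_fderiv ?_
  ext v
  simp only [add_apply, neg_apply,
    smul_apply, sum_apply, ContinuousLinearMap.proj_apply,
    smul_eq_mul, Matrix.mulVec, dotProduct, zvec, sub_mul, Finset.sum_sub_distrib,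
    Finset.sum_mul, Finset.mul_sum]
  rw [Finset.sum_comm, neg_add_eq_sub]
  congr 1
  · exact Finset.sum_congr rfl fun j _ => Finset.sum_congr rfl fun i _ => by ring
  · exact Finset.sum_congr rfl fun j _ => by ring
end

section
/- Fix x ∈ ℝ^n, μ > 0, ρ > 0. The gradient map λ ↦ A·z(x,λ;μ,ρ) − ρb of η(x,·;μ,ρ) is Fréchet differentiable at every λ ∈ ℝ^m, with derivative h ↦ A·(z_i/(s_i+z_i)·(Aᵀh)_i)_{i=1,…,n}; that is, the Hessian of η(x,·;μ,ρ) is ∇²_λη = A·H⁻¹W·Aᵀ where W := diag(ρμ/s_i²), H := I + W, and H⁻¹W = diag(z_i/(s_i+z_i)) (the identity H⁻¹W = L(z)(L(z+s))⁻¹ of Theorem 4.3 specialized to the nonnegative orthant, using s_i z_i = ρμ). -/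
open scoped BigOperators

/-- Derivative of the positive root `(√(u² + a) + u) / 2` for `a > 0`. -/
theorem hasDerivAt_half_sqrt_sq_add_add {a : ℝ} (ha : 0 < a) (u : ℝ) :
    HasDerivAt (fun v : ℝ => (Real.sqrt (v ^ 2 + a) + v) / 2)
      ((Real.sqrt (u ^ 2 + a) + u) / 2 /
        ((Real.sqrt (u ^ 2 + a) - u) / 2 + (Real.sqrt (u ^ 2 + a) + u) / 2)) u := by
  have hpos : 0 < u ^ 2 + a := by positivity
  have hsqrt : Real.sqrt (u ^ 2 + a) ≠ 0 := (Real.sqrt_pos.mpr hpos).ne'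
  have h := (((((hasDerivAt_id u).pow 2).add_const a).sqrt hpos.ne').add
    (hasDerivAt_id u)).div_const 2
  refine h.congr_deriv ?_
  have hsum : (Real.sqrt (u ^ 2 + a) - u) / 2 + (Real.sqrt (u ^ 2 + a) + u) / 2
      = Real.sqrt (u ^ 2 + a) := by ring
  rw [hsum]
  simp only [Pi.pow_apply, id_eq]
  field_simp
  push_cast
  ring

/-- the gradient map `λ ↦ A z(x,λ;μ,ρ) - ρ b` is Fréchet differentiable,
with derivative `h ↦ A ((zᵢ/(sᵢ+zᵢ))·(Aᵀh)ᵢ)ᵢ`, i.e. the Hessian of `η(x,·;μ,ρ)`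
is `A H⁻¹ W Aᵀ`, where `H⁻¹W = diag (zᵢ/(sᵢ+zᵢ))`. -/
theorem stmt5 {m n : ℕ} (A : Matrix (Fin m) (Fin n) ℝ) (b : Fin m → ℝ) (c : Fin n → ℝ)
    (x : Fin n → ℝ) (μ ρ : ℝ) (hμ : 0 < μ) (hρ : 0 < ρ) :
    ∀ lam : Fin m → ℝ,
      HasFDerivAt
        (fun l : Fin m → ℝ => fun j => A.mulVec (zvec A c x l μ ρ) j - ρ * b j)
        ((LinearMap.toContinuousLinearMap (Matrix.mulVecLin A)).comp
          (ContinuousLinearMap.pi fun i =>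
            (zvec A c x lam μ ρ i /
              (svec A c x lam μ ρ i + zvec A c x lam μ ρ i)) •
              ((ContinuousLinearMap.proj i : (Fin n → ℝ) →L[ℝ] ℝ).comp
                (LinearMap.toContinuousLinearMap (Matrix.mulVecLin A.transpose))))) lam := by
  intro lam
  have hz : HasFDerivAt (fun l : Fin m → ℝ => zvec A c x l μ ρ)
      (ContinuousLinearMap.pi fun i =>
        (zvec A c x lam μ ρ i / (svec A c x lam μ ρ i + zvec A c x lam μ ρ i)) •
          ((ContinuousLinearMap.proj i : (Fin n → ℝ) →L[ℝ] ℝ).comp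
            (LinearMap.toContinuousLinearMap (Matrix.mulVecLin A.transpose)))) lam := by
    refine hasFDerivAt_pi.mpr fun i => ?_
    have hu : HasFDerivAt (fun l : Fin m → ℝ => ρ * x i - c i + A.transpose.mulVec l i)
        ((ContinuousLinearMap.proj i : (Fin n → ℝ) →L[ℝ] ℝ).comp
          (LinearMap.toContinuousLinearMap (Matrix.mulVecLin A.transpose))) lam :=
      ((ContinuousLinearMap.proj i : (Fin n → ℝ) →L[ℝ] ℝ).comp
        (LinearMap.toContinuousLinearMap
          (Matrix.mulVecLin A.transpose))).hasFDerivAt.const_add (ρ * x i - c i)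
    have ha : 0 < 4 * ρ * μ := by positivity
    exact (hasDerivAt_half_sqrt_sq_add_add ha _).comp_hasFDerivAt lam hu
  have hA := (LinearMap.toContinuousLinearMap (Matrix.mulVecLin A)).hasFDerivAt.comp lam hz
  exact hA.sub_const fun j => ρ * b j
end

section
/- Fix λ ∈ ℝ^m, μ > 0, ρ > 0. The function x ↦ η(x,λ;μ,ρ) is differentiable on ℝ^n, and its gradient at every x equals ρ·(Aᵀλ + s(x,λ;μ,ρ) − c). -/
open scoped BigOperators

/-- The smoothed negative part `(√(u² + q) - u) / 2` is positive for `q > 0`. -/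
theorem sqrt_sq_add_sub_half_pos {q : ℝ} (hq : 0 < q) (u : ℝ) :
    0 < (Real.sqrt (u ^ 2 + q) - u) / 2 := by
  have h : u < Real.sqrt (u ^ 2 + q) := Real.lt_sqrt_of_sq_lt (by linarith)
  linarith

/-- One coordinate of the augmented Lagrangian. The first-order condition satisfied by `s` makes
the contribution of its derivative vanish. -/
theorem hasDerivAt_augmentedLagrangian_coord (a c μ ρ : ℝ) (hμ : 0 < μ) (hρ : 0 < ρ)
    (s : ℝ → ℝ)
    (hs : ∀ t, s t = (Real.sqrt ((ρ * t - c + a) ^ 2 + 4 * ρ * μ) - (ρ * t - c + a)) / 2)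
    (t : ℝ) :
    HasDerivAt
      (fun t => -(ρ * μ * Real.log (s t)) + ρ * (t * (a + s t - c)) + 1 / 2 * (a + s t - c) ^ 2)
      (ρ * (a + s t - c)) t := by
  have hq : 0 < 4 * ρ * μ := by positivity
  have hrad : (ρ * t - c + a) ^ 2 + 4 * ρ * μ ≠ 0 := by positivity
  have hpos : 0 < s t := hs t ▸ sqrt_sq_add_sub_half_pos hq _
  have hquad : s t ^ 2 + (ρ * t - c + a) * s t = ρ * μ := by
    have h := Real.sq_sqrt (show 0 ≤ (ρ * t - c + a) ^ 2 + 4 * ρ * μ by positivity)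
    rw [hs t]
    linear_combination h / 4
  have hdiff : DifferentiableAt ℝ s t := by
    rw [funext hs]
    have hu : DifferentiableAt ℝ (fun t => ρ * t - c + a) t := by fun_prop
    exact ((((hu.pow 2).add_const _).sqrt hrad).sub hu).div_const 2
  obtain ⟨s', hs'⟩ : ∃ s', HasDerivAt s s' t := ⟨_, hdiff.hasDerivAt⟩
  have hr : HasDerivAt (fun t => a + s t - c) s' t := (hs'.const_add a).sub_const c
  have h := ((((hs'.log hpos.ne').const_mul (ρ * μ)).neg).add
    (((hasDerivAt_id t).mul hr).const_mul ρ)).add ((hr.pow 2).const_mul (1 / 2))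
  refine h.congr_deriv ?_
  have hne := hpos.ne'
  simp only [id_eq]
  field_simp
  push_cast
  linear_combination (2 * s') * hquad

/-- The augmented Lagrangian is a constant plus a sum of functions of single coordinates. -/
theorem eta_eq_sum {m n : ℕ} (A : Matrix (Fin m) (Fin n) ℝ) (b : Fin m → ℝ)
    (c x : Fin n → ℝ) (lam : Fin m → ℝ) (μ ρ : ℝ) :
    eta A b c x lam μ ρ = -(ρ * ∑ j, b j * lam j) +
      ∑ i, (-(ρ * μ * Real.log (svec A c x lam μ ρ i))
        + ρ * (x i * (A.transpose.mulVec lam i + svec A c x lam μ ρ i - c i))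
        + 1 / 2 * (A.transpose.mulVec lam i + svec A c x lam μ ρ i - c i) ^ 2) := by
  simp only [eta, Lag, phi, Finset.sum_add_distrib, Finset.mul_sum, Finset.sum_neg_distrib,
    mul_neg]
  ring

/-- `x ↦ η(x,λ;μ,ρ)` is differentiable with gradient `ρ (Aᵀλ + s - c)`. -/
theorem stmt6 {m n : ℕ} (A : Matrix (Fin m) (Fin n) ℝ) (b : Fin m → ℝ) (c : Fin n → ℝ)
    (lam : Fin m → ℝ) (μ ρ : ℝ) (hμ : 0 < μ) (hρ : 0 < ρ) :
    ∀ x : Fin n → ℝ,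
      HasFDerivAt (fun x' : Fin n → ℝ => eta A b c x' lam μ ρ)
        (∑ i, (ρ * (A.transpose.mulVec lam i + svec A c x lam μ ρ i - c i)) •
          (ContinuousLinearMap.proj i : (Fin n → ℝ) →L[ℝ] ℝ)) x := by
  intro x
  simp only [eta_eq_sum]
  refine (HasFDerivAt.fun_sum fun i _ => ?_).const_add _
  exact (hasDerivAt_augmentedLagrangian_coord (A.transpose.mulVec lam i) (c i) μ ρ hμ hρ _
    (fun _ => rfl) (x i)).comp_hasFDerivAt x
    (ContinuousLinearMap.proj i : (Fin n → ℝ) →L[ℝ] ℝ).hasFDerivAt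
end

section
/- Fix x ∈ ℝ^n, μ > 0, ρ > 0, and assume A has full row rank (equivalently, Aᵀλ = 0 implies λ = 0). Then the function λ ↦ η(x,λ;μ,ρ) is strictly convex on ℝ^m. -/
open scoped BigOperators

/-- The one-dimensional profile of the augmented Lagrangian, as a function of `u = z - s`
with `z * s = k`. -/
noncomputable def etaProfile (k u : ℝ) : ℝ :=
  -(k * Real.log ((Real.sqrt (u ^ 2 + 4 * k) - u) / 2))
    + ((Real.sqrt (u ^ 2 + 4 * k) + u) / 2) ^ 2 / 2

lemma abs_lt_sqrt_sq_add {k : ℝ} (hk : 0 < k) (u : ℝ) : |u| < Real.sqrt (u ^ 2 + 4 * k) := by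
  rw [← Real.sqrt_sq_eq_abs]
  exact Real.sqrt_lt_sqrt (sq_nonneg u) (by linarith)

lemma neg_log_add_sq_tangent_lt {s z t w : ℝ} (hs : 0 < s) (hz : 0 < z) (ht : 0 < t)
    (hne : w ≠ z) :
    -(z * s * Real.log s) + z ^ 2 / 2 + z * ((w - t) - (z - s))
      < -(z * s * Real.log t) + w ^ 2 / 2 := by
  have hlog : Real.log t - Real.log s ≤ t / s - 1 := by
    rw [← Real.log_div ht.ne' hs.ne']
    exact Real.log_le_sub_one_of_pos (div_pos ht hs)
  have hmul := mul_le_mul_of_nonneg_left hlog (mul_pos hz hs).le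
  have hdiv : z * s * (t / s - 1) = z * t - z * s := by field_simp
  have hsq : 0 < (w - z) ^ 2 := by
    have := sub_ne_zero.mpr hne
    positivity
  nlinarith

lemma etaProfile_tangent_lt {k u v : ℝ} (hk : 0 < k) (hne : u ≠ v) :
    etaProfile k u + (Real.sqrt (u ^ 2 + 4 * k) + u) / 2 * (v - u) < etaProfile k v := by
  unfold etaProfile
  have hu := abs_lt.mp (abs_lt_sqrt_sq_add hk u)
  have hv := abs_lt.mp (abs_lt_sqrt_sq_add hk v)
  have hu2 := Real.sq_sqrt (show 0 ≤ u ^ 2 + 4 * k by positivity)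
  have hv2 := Real.sq_sqrt (show 0 ≤ v ^ 2 + 4 * k by positivity)
  set p := Real.sqrt (u ^ 2 + 4 * k)
  set q := Real.sqrt (v ^ 2 + 4 * k)
  have hpu : (p + u) / 2 * ((p - u) / 2) = k := by linear_combination hu2 / 4
  have hqv : (q + v) / 2 * ((q - v) / 2) = k := by linear_combination hv2 / 4
  have hzw : (q + v) / 2 ≠ (p + u) / 2 := by
    intro h
    rw [h, ← hpu] at hqv
    have := mul_left_cancel₀ (by linarith : (p + u) / 2 ≠ 0) hqv
    exact hne (by linarith)
  have key := neg_log_add_sq_tangent_lt (s := (p - u) / 2) (z := (p + u) / 2)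
    (t := (q - v) / 2) (w := (q + v) / 2) (by linarith) (by linarith) (by linarith)
    hzw
  rw [hpu] at key
  have huv : (q + v) / 2 - (q - v) / 2 - ((p + u) / 2 - (p - u) / 2) = v - u := by ring
  rwa [huv] at key

lemma strictConvexOn_etaProfile {k : ℝ} (hk : 0 < k) :
    StrictConvexOn ℝ Set.univ (etaProfile k) := by
  refine ⟨convex_univ, fun u _ v _ hne a b ha hb hab => ?_⟩
  simp only [smul_eq_mul]
  obtain rfl : a = 1 - b := by linarith
  have hsub : u - v ≠ 0 := sub_ne_zero.mpr hne
  have hu := etaProfile_tangent_lt hk (u := (1 - b) * u + b * v) (v := u) (fun h =>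
    mul_ne_zero hb.ne' hsub (by linarith))
  have hv := etaProfile_tangent_lt hk (u := (1 - b) * u + b * v) (v := v) (fun h =>
    mul_ne_zero ha.ne' hsub (by linarith))
  have hu' := mul_lt_mul_of_pos_left hu ha
  have hv' := mul_lt_mul_of_pos_left hv hb
  linear_combination hu' + hv'

lemma eta_eq_sum_etaProfile {m n : ℕ} (A : Matrix (Fin m) (Fin n) ℝ) (b : Fin m → ℝ)
    (c x : Fin n → ℝ) (l : Fin m → ℝ) (μ ρ : ℝ) :
    eta A b c x l μ ρ = -(ρ * ∑ j, b j * l j)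
      + ∑ i, etaProfile (ρ * μ) (ρ * x i - c i + A.transpose.mulVec l i)
      - ∑ i, (ρ * x i) ^ 2 / 2 := by
  simp only [eta, Lag, phi, svec, mul_neg, Finset.mul_sum, ← Finset.sum_neg_distrib]
  rw [add_assoc, add_assoc, add_sub_assoc, ← Finset.sum_add_distrib, ← Finset.sum_add_distrib,
    ← Finset.sum_sub_distrib]
  congr 1
  refine Finset.sum_congr rfl fun i _ => ?_
  rw [etaProfile, mul_assoc 4 ρ μ]
  ring

/-- if `A` has full row rank then `λ ↦ η(x,λ;μ,ρ)` is strictly convex. -/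
theorem stmt7 {m n : ℕ} (A : Matrix (Fin m) (Fin n) ℝ) (b : Fin m → ℝ) (c : Fin n → ℝ)
    (x : Fin n → ℝ) (μ ρ : ℝ) (hμ : 0 < μ) (hρ : 0 < ρ)
    (hA : ∀ l : Fin m → ℝ, A.transpose.mulVec l = 0 → l = 0) :
    StrictConvexOn ℝ Set.univ (fun l : Fin m → ℝ => eta A b c x l μ ρ) := by
  refine ⟨convex_univ, fun l _ l' _ hne p q hp hq hpq => ?_⟩
  have hk : 0 < ρ * μ := mul_pos hρ hμ
  have hconv := strictConvexOn_etaProfile hk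
  have harg : ∀ i, ρ * x i - c i + A.transpose.mulVec (p • l + q • l') i
      = p • (ρ * x i - c i + A.transpose.mulVec l i)
        + q • (ρ * x i - c i + A.transpose.mulVec l' i) := by
    intro i
    simp only [Matrix.mulVec_add, Matrix.mulVec_smul, Pi.add_apply, Pi.smul_apply, smul_eq_mul]
    linear_combination (-(ρ * x i - c i)) * hpq
  obtain ⟨i₀, hi₀⟩ : ∃ i, A.transpose.mulVec l i ≠ A.transpose.mulVec l' i := by
    by_contra! h
    refine hne (sub_eq_zero.mp (hA _ ?_))
    rw [Matrix.mulVec_sub, funext h, sub_self]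
  have hsum : ∑ i, etaProfile (ρ * μ) (ρ * x i - c i + A.transpose.mulVec (p • l + q • l') i)
      < ∑ i, (p • etaProfile (ρ * μ) (ρ * x i - c i + A.transpose.mulVec l i)
        + q • etaProfile (ρ * μ) (ρ * x i - c i + A.transpose.mulVec l' i)) := by
    refine Finset.sum_lt_sum (fun i _ => ?_) ⟨i₀, Finset.mem_univ _, ?_⟩
    · rw [harg]
      exact hconv.convexOn.2 (Set.mem_univ _) (Set.mem_univ _) hp.le hq.le hpq
    · rw [harg]
      exact hconv.2 (Set.mem_univ _) (Set.mem_univ _) (fun h => hi₀ (add_left_cancel h)) hp hq hpq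
  have hlin : ∑ j, b j * (p • l + q • l') j = p * ∑ j, b j * l j + q * ∑ j, b j * l' j := by
    simp only [Finset.mul_sum, ← Finset.sum_add_distrib]
    refine Finset.sum_congr rfl fun j _ => ?_
    simp only [Pi.add_apply, Pi.smul_apply, smul_eq_mul]
    ring
  simp only [eta_eq_sum_etaProfile, hlin]
  simp only [smul_eq_mul, Finset.sum_add_distrib, ← Finset.mul_sum] at hsum ⊢
  obtain rfl : p = 1 - q := by linarith
  linear_combination hsum
end

section
/- Fix λ ∈ ℝ^m, μ > 0, ρ > 0. Then the function x ↦ η(x,λ;μ,ρ) is strictly concave on ℝ^n. -/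
open scoped BigOperators

/-- One coordinate of the augmented Lagrangian, with `d` the corresponding entry of `Aᵀλ - c`. -/
noncomputable def coordLag (d μ ρ x s : ℝ) : ℝ :=
  -(ρ * μ * Real.log s) + ρ * (x * (d + s)) + (1 / 2) * (d + s) ^ 2

lemma coordLag_convex_comb (d μ ρ x y s : ℝ) {p q : ℝ} (hpq : p + q = 1) :
    coordLag d μ ρ (p * x + q * y) s = p * coordLag d μ ρ x s + q * coordLag d μ ρ y s := by
  obtain rfl : q = 1 - p := by linarith
  unfold coordLag
  ring

/-- A point satisfying the stationarity equation minimizes the coordinate Lagrangian in `s`,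
with quadratic growth. -/
lemma coordLag_add_sq_le {d μ ρ x s t : ℝ} (hμ : 0 < μ) (hρ : 0 < ρ) (hs : 0 < s) (ht : 0 < t)
    (h : s ^ 2 + (ρ * x + d) * s = ρ * μ) :
    coordLag d μ ρ x s + (1 / 2) * (t - s) ^ 2 ≤ coordLag d μ ρ x t := by
  have hlog : Real.log t - Real.log s ≤ t / s - 1 := by
    rw [← Real.log_div ht.ne' hs.ne']
    exact Real.log_le_sub_one_of_pos (div_pos ht hs)
  have hmul := mul_le_mul_of_nonneg_left hlog (mul_pos hρ hμ).le
  have hlin : ρ * μ * (t / s - 1) = (s + ρ * x + d) * (t - s) := by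
    rw [← h]
    field_simp
    ring
  unfold coordLag
  nlinarith

section svec

variable {m n : ℕ} (A : Matrix (Fin m) (Fin n) ℝ) (c x : Fin n → ℝ) (lam : Fin m → ℝ) {μ ρ : ℝ}

lemma svec_pos (hμ : 0 < μ) (hρ : 0 < ρ) (i : Fin n) : 0 < svec A c x lam μ ρ i := by
  have hρμ := mul_pos hρ hμ
  unfold svec
  have := Real.lt_sqrt_of_sq_lt
    (show (ρ * x i - c i + A.transpose.mulVec lam i) ^ 2
      < (ρ * x i - c i + A.transpose.mulVec lam i) ^ 2 + 4 * ρ * μ by linarith)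
  linarith

lemma svec_stationary (hμ : 0 < μ) (hρ : 0 < ρ) (i : Fin n) :
    svec A c x lam μ ρ i ^ 2 + (ρ * x i + (A.transpose.mulVec lam i - c i)) * svec A c x lam μ ρ i
      = ρ * μ := by
  have := Real.sq_sqrt
    (show 0 ≤ (ρ * x i - c i + A.transpose.mulVec lam i) ^ 2 + 4 * ρ * μ by positivity)
  unfold svec
  linarith

lemma eta_eq_sum_coordLag (b : Fin m → ℝ) :
    eta A b c x lam μ ρ = -(ρ * ∑ j, b j * lam j)
      + ∑ i, coordLag (A.transpose.mulVec lam i - c i) μ ρ (x i) (svec A c x lam μ ρ i) := by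
  simp only [eta, Lag, phi, coordLag, Finset.sum_add_distrib, Finset.sum_neg_distrib,
    ← Finset.mul_sum, add_sub_right_comm]
  ring

end svec

/-- `x ↦ η(x,λ;μ,ρ)` is strictly concave on `ℝⁿ`. -/
theorem stmt8 {m n : ℕ} (A : Matrix (Fin m) (Fin n) ℝ) (b : Fin m → ℝ) (c : Fin n → ℝ)
    (lam : Fin m → ℝ) (μ ρ : ℝ) (hμ : 0 < μ) (hρ : 0 < ρ) :
    StrictConcaveOn ℝ Set.univ (fun x : Fin n → ℝ => eta A b c x lam μ ρ) := by
  refine ⟨convex_univ, ?_⟩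
  intro x _ y _ hxy p q hp hq hpq
  obtain ⟨k, hk⟩ := Function.ne_iff.mp hxy
  set w := p • x + q • y with hw
  have hpos := fun v i => svec_pos A c v lam hμ hρ i
  have hstat := fun v i => svec_stationary A c v lam hμ hρ i
  have hcomb (i : Fin n) := coordLag_convex_comb (A.transpose.mulVec lam i - c i) μ ρ (x i) (y i)
    (svec A c w lam μ ρ i) hpq
  have hgrow := fun v i => coordLag_add_sq_le hμ hρ (hpos v i) (hpos w i) (hstat v i)
  have hwi (i : Fin n) : w i = p * x i + q * y i := by simp [hw]
  have hsum : ∑ i, (p * coordLag (A.transpose.mulVec lam i - c i) μ ρ (x i) (svec A c x lam μ ρ i)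
        + q * coordLag (A.transpose.mulVec lam i - c i) μ ρ (y i) (svec A c y lam μ ρ i))
      < ∑ i, coordLag (A.transpose.mulVec lam i - c i) μ ρ (w i) (svec A c w lam μ ρ i) := by
    refine Finset.sum_lt_sum (fun i _ => ?_) ⟨k, Finset.mem_univ k, ?_⟩
    · rw [hwi, hcomb]
      have hx := hgrow x i
      have hy := hgrow y i
      gcongr <;> nlinarith [sq_nonneg (svec A c w lam μ ρ i - svec A c x lam μ ρ i),
        sq_nonneg (svec A c w lam μ ρ i - svec A c y lam μ ρ i)]
    · have hne : svec A c w lam μ ρ k ≠ svec A c x lam μ ρ k := by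
        intro heq
        have h₁ := hstat w k
        rw [heq, ← hstat x k, hwi] at h₁
        have h₂ : ρ * q * svec A c x lam μ ρ k * (y k - x k) = 0 := by
          obtain rfl : p = 1 - q := by linarith
          linear_combination h₁
        have := (mul_pos (mul_pos hρ hq) (hpos x k)).ne'
        exact hk (sub_eq_zero.mp ((mul_eq_zero.mp h₂).resolve_left this)).symm
      rw [hwi, hcomb]
      have hx := hgrow x k
      have hy := hgrow y k
      have hsq := sq_pos_of_ne_zero (sub_ne_zero.mpr hne)
      refine add_lt_add_of_lt_of_le (mul_lt_mul_of_pos_left ?_ hp)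
        (mul_le_mul_of_nonneg_left ?_ hq.le)
      · linarith
      · linarith [sq_nonneg (svec A c w lam μ ρ k - svec A c y lam μ ρ k)]
  rw [Finset.sum_add_distrib, ← Finset.mul_sum, ← Finset.mul_sum] at hsum
  simp only [smul_eq_mul, eta_eq_sum_coordLag]
  obtain rfl : p = 1 - q := by linarith
  linarith
end

section
/- (Theorem 3.5(b), orthant case.) Fix x ∈ ℝ^n, λ ∈ ℝ^m, ρ > 0 (so u := ρx − c + Aᵀλ is fixed), and for μ > 0 let s(μ) := s(x,λ;μ,ρ), z(μ) := z(x,λ;μ,ρ). For each h ∈ ℝ^m define ψ(μ) := ∑_{i=1}^n (z_i(μ)/(s_i(μ)+z_i(μ)))·(Aᵀh)_i² (that is, ψ(μ) = hᵀ∇²_λη(x,λ;μ,ρ)h). Then ψ is differentiable on (0,∞) and |ψ'(μ)| ≤ ((1 + 2√n)/μ)·ψ(μ) for every μ > 0. -/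
open scoped BigOperators

/-- The smoothed weight `(√(u² + 4ρμ) + u) / (2√(u² + 4ρμ))`, written as `z / (s + z)`, has
derivative in `μ` bounded by the weight divided by `μ`. -/
theorem exists_hasDerivAt_weight_abs_le (u : ℝ) {ρ μ : ℝ} (hρ : 0 < ρ) (hμ : 0 < μ) :
    ∃ d : ℝ, HasDerivAt (fun t : ℝ => (Real.sqrt (u ^ 2 + 4 * ρ * t) + u) / 2 /
        ((Real.sqrt (u ^ 2 + 4 * ρ * t) - u) / 2 + (Real.sqrt (u ^ 2 + 4 * ρ * t) + u) / 2)) d μ ∧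
      |d| ≤ 1 / μ * ((Real.sqrt (u ^ 2 + 4 * ρ * μ) + u) / 2 /
        ((Real.sqrt (u ^ 2 + 4 * ρ * μ) - u) / 2 +
          (Real.sqrt (u ^ 2 + 4 * ρ * μ) + u) / 2)) := by
  have hpos : 0 < u ^ 2 + 4 * ρ * μ := by positivity
  have hlin : HasDerivAt (fun t : ℝ => u ^ 2 + 4 * ρ * t) (4 * ρ) μ := by
    simpa using ((hasDerivAt_id μ).const_mul (4 * ρ)).const_add (u ^ 2)
  have hsqrt := hlin.sqrt hpos.ne'
  have hr := Real.sqrt_pos.mpr hpos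
  have hsq := Real.sq_sqrt hpos.le
  have habs : |u| ≤ Real.sqrt (u ^ 2 + 4 * ρ * μ) :=
    Real.abs_le_sqrt (by nlinarith [mul_pos hρ hμ])
  have hden (r : ℝ) : (r - u) / 2 + (r + u) / 2 = r := by ring
  simp only [hden]
  refine ⟨_, ((hsqrt.add_const u).div_const 2).div hsqrt hr.ne', ?_⟩
  generalize Real.sqrt (u ^ 2 + 4 * ρ * μ) = r at *
  have hd : (4 * ρ / (2 * r) / 2 * r - (r + u) / 2 * (4 * ρ / (2 * r))) / r ^ 2
      = -u * ρ / r ^ 3 := by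
    field_simp
    ring
  have hru : 0 ≤ r + u := by linarith [neg_abs_le u]
  have hprod : |u| * (r - u) ≤ 2 * r ^ 2 := by
    nlinarith [mul_le_mul habs (show r - u ≤ 2 * r by linarith) (by linarith [le_abs_self u]) hr.le]
  have hmul := mul_le_mul_of_nonneg_right hprod hru
  have key : 2 * |u| * ρ * μ ≤ r ^ 2 * (r + u) := by
    have hfac : |u| * (r - u) * (r + u) = |u| * (4 * ρ * μ) := by
      linear_combination |u| * hsq
    linarith
  rw [hd, abs_div, abs_mul, abs_neg, abs_of_pos hρ, abs_of_pos (pow_pos hr 3),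
    one_div_mul_eq_div, div_div, div_div, div_le_div_iff₀ (by positivity) (by positivity)]
  nlinarith [mul_le_mul_of_nonneg_right key hr.le]

/-- Theorem 3.5(b), orthant case: the Hessian quadratic form
`ψ(μ) = ∑ (zᵢ(μ)/(sᵢ(μ)+zᵢ(μ)))·(Aᵀh)ᵢ²` is differentiable on `(0,∞)` and
`|ψ'(μ)| ≤ ((1+2√n)/μ)·ψ(μ)`. -/
theorem stmt11 {m n : ℕ} (A : Matrix (Fin m) (Fin n) ℝ) (c : Fin n → ℝ)
    (x : Fin n → ℝ) (lam : Fin m → ℝ) (ρ : ℝ) (hρ : 0 < ρ) (h : Fin m → ℝ) :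
    ∀ μ : ℝ, 0 < μ →
      DifferentiableAt ℝ
        (fun μ' : ℝ => ∑ i, (zvec A c x lam μ' ρ i /
          (svec A c x lam μ' ρ i + zvec A c x lam μ' ρ i)) *
            (A.transpose.mulVec h i) ^ 2) μ ∧
      |deriv (fun μ' : ℝ => ∑ i, (zvec A c x lam μ' ρ i /
          (svec A c x lam μ' ρ i + zvec A c x lam μ' ρ i)) *
            (A.transpose.mulVec h i) ^ 2) μ| ≤
        ((1 + 2 * Real.sqrt n) / μ) *
          (∑ i, (zvec A c x lam μ ρ i /
            (svec A c x lam μ ρ i + zvec A c x lam μ ρ i)) *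
              (A.transpose.mulVec h i) ^ 2) := by
  intro μ hμ
  choose d hd hle using fun i =>
    exists_hasDerivAt_weight_abs_le (ρ * x i - c i + A.transpose.mulVec lam i) hρ hμ
  have hsum := HasDerivAt.fun_sum (u := Finset.univ) fun i _ =>
    (hd i).mul_const (A.transpose.mulVec h i ^ 2)
  refine ⟨hsum.differentiableAt, ?_⟩
  refine (congrArg abs hsum.deriv).trans_le ?_
  rw [Finset.mul_sum]
  refine (Finset.abs_sum_le_sum_abs _ _).trans (Finset.sum_le_sum fun i _ => ?_)
  have hw := (abs_nonneg _).trans (hle i)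
  rw [abs_mul, abs_of_nonneg (sq_nonneg (A.transpose.mulVec h i)), ← mul_assoc]
  refine mul_le_mul_of_nonneg_right ((hle i).trans ?_) (sq_nonneg _)
  refine mul_le_mul_of_nonneg_right ?_ (nonneg_of_mul_nonneg_right hw (by positivity))
  gcongr
  linarith [Real.sqrt_nonneg (n : ℝ)]
end

section
/- (Core inequality of Lemma 4.1 certifying monotonicity, orthant case.) Let n ≥ 1, σ ∈ (0,1), ρ > 0, and let ω be a real number with ω > √σ·n/((1−√σ)·ρ). Then for every x ∈ (0,∞)^n, every μ̂ > 0, every h ∈ ℝ^n, and every h₀ ∈ ℝ: (μ̂²/ρ)·∑_{i=1}^n h_i²/x_i² − (2h₀μ̂/ρ)·∑_{i=1}^n h_i/x_i + ((1−√σ)/√σ)·ω·h₀² ≥ 0. (This is the quadratic form ⟨ȟ, (1/2)(D M + (D M)*)[ȟ]⟩_ω with ȟ = (h,h₀), specialized to the nonnegative orthant where ∇²φ(y) = diag(1/y_i²) and ν = n; its nonnegativity makes the operator M, hence C_{(ρ,σ)}T, monotone on int(K) × ℝ₊₊.) -/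
open scoped BigOperators

/-- core inequality of Lemma 4.1, orthant case: nonnegativity of the
symmetrized quadratic form certifying monotonicity of the operator `M`. -/
theorem stmt12 (n : ℕ) (hn : 1 ≤ n) (σ ρ ω : ℝ) (hσ : σ ∈ Set.Ioo (0 : ℝ) 1)
    (hρ : 0 < ρ) (hω : Real.sqrt σ * n / ((1 - Real.sqrt σ) * ρ) < ω) :
    ∀ x : Fin n → ℝ, (∀ i, 0 < x i) → ∀ mhat : ℝ, 0 < mhat →
      ∀ h : Fin n → ℝ, ∀ h0 : ℝ,
        0 ≤ mhat ^ 2 / ρ * ∑ i, (h i) ^ 2 / (x i) ^ 2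
            - (2 * h0 * mhat / ρ) * ∑ i, h i / x i
            + ((1 - Real.sqrt σ) / Real.sqrt σ) * ω * h0 ^ 2 := by
  intro x _ mhat _ h h0
  have hs : 0 < Real.sqrt σ := Real.sqrt_pos.mpr hσ.1
  have hs1 : 0 < 1 - Real.sqrt σ :=
    sub_pos.mpr ((Real.sqrt_lt' one_pos).mpr (by simpa using hσ.2))
  have hcoef : n / ρ ≤ (1 - Real.sqrt σ) / Real.sqrt σ * ω := by
    rw [div_lt_iff₀ (mul_pos hs1 hρ)] at hω
    rw [div_mul_eq_mul_div, div_le_div_iff₀ hρ hs]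
    linarith
  have hsq : ∑ i, (mhat * (h i / x i) - h0) ^ 2 / ρ =
      mhat ^ 2 / ρ * ∑ i, (h i) ^ 2 / (x i) ^ 2
        - (2 * h0 * mhat / ρ) * ∑ i, h i / x i + n / ρ * h0 ^ 2 := by
    have hconst : (n : ℝ) / ρ * h0 ^ 2 = ∑ _i : Fin n, h0 ^ 2 / ρ := by
      simp only [Finset.sum_const, Finset.card_univ, Fintype.card_fin, nsmul_eq_mul]
      ring
    rw [hconst, Finset.mul_sum, Finset.mul_sum, ← Finset.sum_sub_distrib,
      ← Finset.sum_add_distrib]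
    refine Finset.sum_congr rfl fun i _ => ?_
    rw [← div_pow]
    ring
  have hnonneg : 0 ≤ ∑ i, (mhat * (h i / x i) - h0) ^ 2 / ρ :=
    Finset.sum_nonneg fun i _ => by positivity
  have hle := mul_le_mul_of_nonneg_right hcoef (sq_nonneg h0)
  linarith
end

section
/- (Proposition 5.7, orthant case: level boundedness of the subproblem objective.) Assume A has full row rank (Aᵀλ = 0 implies λ = 0), there exists x₀ ∈ (0,∞)^n with A·x₀ = b (primal Slater condition), and there exist λ₀ ∈ ℝ^m and s₀ ∈ (0,∞)^n with Aᵀλ₀ + s₀ = c (dual Slater condition). Then for every fixed x ∈ ℝ^n, μ > 0, ρ > 0 and every r ∈ ℝ, the sublevel set { λ ∈ ℝ^m : η(x,λ;μ,ρ) ≤ r } is bounded. -/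
open scoped BigOperators

/-- Each coordinate of `η`, as a function of `v = (Aᵀλ)ᵢ`, grows at least linearly in `|v|`. -/
lemma exists_abs_le_coordinate {p μ ρ : ℝ} (hp : 0 < p) (hμ : 0 < μ) (hρ : 0 < ρ) (x c : ℝ) :
    ∃ C : ℝ, ∀ v s : ℝ,
      s = (Real.sqrt ((ρ * x - c + v) ^ 2 + 4 * ρ * μ) - (ρ * x - c + v)) / 2 →
      ρ * p / 2 * |v| ≤ -(ρ * (p * v)) + ρ * μ * -Real.log s + ρ * (x * (v + s - c))
        + 1 / 2 * (v + s - c) ^ 2 + C := by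
  refine ⟨ρ * p / 2 * |ρ * x - c| - ρ * μ * (1 + Real.log (p / (2 * μ))) + 2 * (ρ * p) ^ 2
    + ρ * p * |ρ * x - c| + ρ ^ 2 * x ^ 2 / 2, fun v s hs => ?_⟩
  set w := ρ * x - c with hw
  set R := Real.sqrt ((w + v) ^ 2 + 4 * ρ * μ) with hR
  have hρμ : 0 < ρ * μ := mul_pos hρ hμ
  have hlt : |w + v| < R := Real.lt_sqrt_of_sq_lt (by rw [sq_abs]; linarith)
  have hs0 : 0 < s := by have := (abs_lt.1 hlt).2; linarith
  have ht : 0 < p / (2 * μ) := by positivity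
  have hlog : Real.log s ≤ p / (2 * μ) * s - 1 - Real.log (p / (2 * μ)) := by
    have h := Real.log_le_sub_one_of_pos (mul_pos ht hs0)
    rw [Real.log_mul ht.ne' hs0.ne'] at h
    linarith
  have hlog' : ρ * μ * Real.log s ≤ ρ * p / 2 * s - ρ * μ * (1 + Real.log (p / (2 * μ))) := by
    refine (mul_le_mul_of_nonneg_left hlog hρμ.le).trans_eq ?_
    field_simp
    ring
  have hρp : 0 < ρ * p := mul_pos hρ hp
  have hv : |v| ≤ R + |w| := by
    have h : |v| ≤ |w + v| + |w| := by simpa using abs_sub (w + v) w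
    linarith
  have hv' := mul_le_mul_of_nonneg_left hv (by positivity : 0 ≤ ρ * p / 2)
  have hw' := mul_le_mul_of_nonneg_left (neg_abs_le w) hρp.le
  have hc : c = ρ * x - w := by rw [hw]; ring
  have hRs : R = 2 * s + (w + v) := by linarith
  rw [hRs] at hv'
  rw [hc]
  nlinarith [sq_nonneg (v + s + w - 2 * (ρ * p))]

/-- Proposition 5.7, orthant case: under full row rank of `A` and the
primal and dual Slater conditions, every sublevel set of `η(x,·;μ,ρ)` is bounded. -/
theorem stmt14 {m n : ℕ} (A : Matrix (Fin m) (Fin n) ℝ) (b : Fin m → ℝ) (c : Fin n → ℝ)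
    (hA : ∀ l : Fin m → ℝ, A.transpose.mulVec l = 0 → l = 0)
    (hP : ∃ x0 : Fin n → ℝ, (∀ i, 0 < x0 i) ∧ A.mulVec x0 = b)
    (hD : ∃ (l0 : Fin m → ℝ) (s0 : Fin n → ℝ), (∀ i, 0 < s0 i) ∧
      (fun i => A.transpose.mulVec l0 i + s0 i) = c)
    (x : Fin n → ℝ) (μ ρ : ℝ) (hμ : 0 < μ) (hρ : 0 < ρ) (r : ℝ) :
    Bornology.IsBounded {lam : Fin m → ℝ | eta A b c x lam μ ρ ≤ r} := by
  obtain ⟨p, hp, rfl⟩ := hP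
  choose C hC using fun i => exists_abs_le_coordinate (hp i) hμ hρ (x i) (c i)
  have hsum : ∀ lam : Fin m → ℝ, eta A (A.mulVec p) c x lam μ ρ ≤ r →
      ∑ i, ρ * p i / 2 * |A.transpose.mulVec lam i| ≤ r + ∑ i, C i := by
    intro lam hlam
    refine (Finset.sum_le_sum fun i _ => hC i _ (svec A c x lam μ ρ i) rfl).trans ?_
    have hdual : ∑ j, A.mulVec p j * lam j = ∑ i, p i * A.transpose.mulVec lam i := by
      change A.mulVec p ⬝ᵥ lam = p ⬝ᵥ A.transpose.mulVec lam
      rw [Matrix.mulVec_transpose, dotProduct_comm, Matrix.dotProduct_mulVec, dotProduct_comm]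
    rw [eta, Lag, phi, hdual] at hlam
    simp only [Finset.sum_add_distrib, Finset.sum_neg_distrib, ← Finset.mul_sum]
    linarith
  obtain ⟨K, -, hK⟩ := A.transpose.mulVecLin.exists_antilipschitzWith
    (LinearMap.ker_eq_bot'.2 fun l hl => hA l hl)
  refine (hK.isBounded_preimage (Bornology.IsBounded.pi fun i =>
    Metric.isBounded_closedBall (x := (0 : ℝ))
      (r := (r + ∑ i, C i) / (ρ * p i / 2)))).subset fun lam hlam i _ => ?_
  have hpi : 0 < ρ * p i / 2 := by have := hp i; positivity
  rw [mem_closedBall_zero_iff, Real.norm_eq_abs, le_div_iff₀' hpi]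
  refine le_trans ?_ (hsum lam hlam)
  exact Finset.single_le_sum (f := fun i => ρ * p i / 2 * |A.transpose.mulVec lam i|)
    (fun j _ => by have := hp j; positivity) (Finset.mem_univ i)
end
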